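/- Let G be a finite tree with vertex set V and let r ∈ V with neighbor set N(r). Then the maximum of F(S) over all connected subsets S ⊆ V with r ∈ S equals a(r) + ∑_{k ∈ N(r)} max( D(r,k), R({r,k}) + M(k→r) ), where M(k→r) denotes the maximum of F_{B(r,k)}(S') over all connected subsets S' of the branch B(r,k) with k ∈ S'. -/

import Mathlib

open scoped Classical

/-- A subset of vertices is connected if the subgraph induced on it is connected. -/
def IsConnSubset {V : Type*} (G : SimpleGraph V) (S : Set V) : Prop :=
  (G.induce S).Connected

/-- The branch `B(r,k)` of a neighbor `k` at `r`: the vertex set of the connected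
component containing `k` of the graph obtained from `G` by deleting the vertex `r`. -/
def branch {V : Type*} (G : SimpleGraph V) (r k : V) : Set V :=
  {v : V | ∃ (hk : k ≠ r) (hv : v ≠ r),
    (G.induce {x : V | x ≠ r}).Reachable ⟨k, hk⟩ ⟨v, hv⟩}

/-- The score `F_W(S)` of a subset `S` computed within the subgraph of `G` induced on `W`:
the sum of the vertex scores `a` over `S`, plus the sum of the edge scores `R` over edges
of `G` with both endpoints in `S`, plus the sum of the decoupling scores `D` over ordered
pairs `(i,j)` of adjacent vertices of `G` lying in `W` with `i ∈ S` and `j ∉ S`.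
Taking `W = Set.univ` gives the full score `F(S)`. -/
noncomputable def score {V : Type*} (G : SimpleGraph V) (a : V → ℝ) (R : Sym2 V → ℝ)
    (D : V → V → ℝ) (W S : Set V) : ℝ :=
  (∑ᶠ v ∈ S, a v)
    + (∑ᶠ e ∈ {e : Sym2 V | e ∈ G.edgeSet ∧ ∀ v ∈ e, v ∈ S}, R e)
    + (∑ᶠ p ∈ {p : V × V | G.Adj p.1 p.2 ∧ p.1 ∈ W ∧ p.2 ∈ W ∧ p.1 ∈ S ∧ p.2 ∉ S},
        D p.1 p.2)


theorem mem_branch_self {V : Type*} {G : SimpleGraph V} {r k : V} (h : G.Adj r k) :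
    k ∈ branch G r k :=
  ⟨h.ne', h.ne', SimpleGraph.Reachable.refl _⟩

theorem ne_of_mem_branch {V : Type*} {G : SimpleGraph V} {r k v : V} (h : v ∈ branch G r k) :
    v ≠ r := h.2.1

theorem mem_branch_of_adj {V : Type*} {G : SimpleGraph V} {r k u v : V}
    (hu : u ∈ branch G r k) (huv : G.Adj u v) (hv : v ≠ r) : v ∈ branch G r k := by
  obtain ⟨hk, hu, h⟩ := hu
  refine ⟨hk, hv, h.trans (SimpleGraph.Adj.reachable ?_)⟩
  simpa using huv

/-- In an acyclic graph, distinct neighbors of `r` have disjoint branches. -/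
theorem eq_of_mem_branch {V : Type*} {G : SimpleGraph V} (hG : G.IsAcyclic) {r k l v : V}
    (hk : G.Adj r k) (hl : G.Adj r l) (hvk : v ∈ branch G r k) (hvl : v ∈ branch G r l) :
    k = l := by
  by_contra hne
  obtain ⟨hkr, _, h₁⟩ := hvk
  obtain ⟨hlr, _, h₂⟩ := hvl
  have hkl := h₁.trans h₂.symm
  have hb : G.IsBridge s(r, k) := SimpleGraph.isAcyclic_iff_forall_isBridge.1 hG hk
  rw [SimpleGraph.isBridge_iff] at hb
  apply hb
  let f : G.induce {x : V | x ≠ r} →g G \ SimpleGraph.fromEdgeSet {s(r, k)} :=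
    { toFun := fun x => x.1
      map_rel' := by
        rintro ⟨x, hx⟩ ⟨y, hy⟩ hxy
        have hxy' : G.Adj x y := by simpa using hxy
        simp only [Set.mem_ofPred_eq] at hx hy
        simp [SimpleGraph.sdiff_adj, hxy', hx, hy] }
  have hkl' := hkl.map f
  have hrl : (G \ SimpleGraph.fromEdgeSet {s(r, k)}).Adj r l := by
    simp [SimpleGraph.sdiff_adj, hl, Ne.symm hne, hkr.symm]
  exact hrl.reachable.trans hkl'.symm

/-- A vertex of `S` reachable from `r` inside `S` is reachable from some neighbor `k` of `r`
inside the part of `S` lying in the branch of `k`. -/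
theorem exists_reachable_inter_branch {V : Type*} {G : SimpleGraph V} {S : Set V} {r : V}
    (hr : r ∈ S) {v : V} (hv : v ∈ S) (hvr : v ≠ r)
    (h : (G.induce S).Reachable ⟨r, hr⟩ ⟨v, hv⟩) :
    ∃ k, G.Adj r k ∧ ∃ (hk : k ∈ S ∩ branch G r k) (hv' : v ∈ S ∩ branch G r k),
      (G.induce (S ∩ branch G r k)).Reachable ⟨k, hk⟩ ⟨v, hv'⟩ := by
  rw [SimpleGraph.reachable_iff_reflTransGen] at h
  suffices ∀ w : S, Relation.ReflTransGen (G.induce S).Adj ⟨r, hr⟩ w → w.1 ≠ r →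
      ∃ k, G.Adj r k ∧ ∃ (hk : k ∈ S ∩ branch G r k) (hv' : w.1 ∈ S ∩ branch G r k),
        (G.induce (S ∩ branch G r k)).Reachable ⟨k, hk⟩ ⟨w.1, hv'⟩ from this _ h hvr
  intro w hw
  induction hw with
  | refl => intro h; exact absurd rfl h
  | @tail u w _ huw ih =>
    intro hwr
    have huw' : G.Adj u.1 w.1 := huw
    by_cases hur : u.1 = r
    · rw [hur] at huw'
      exact ⟨w.1, huw', ⟨w.2, mem_branch_self huw'⟩, ⟨w.2, mem_branch_self huw'⟩,
        SimpleGraph.Reachable.refl _⟩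
    · obtain ⟨k, hk, hkS, huS, hreach⟩ := ih hur
      refine ⟨k, hk, hkS, ⟨w.2, mem_branch_of_adj huS.2 huw' hwr⟩,
        hreach.trans (SimpleGraph.Adj.reachable ?_)⟩
      exact huw'

theorem exists_mem_branch {V : Type*} {G : SimpleGraph V} (hG : G.Connected) {r v : V}
    (hv : v ≠ r) : ∃ k : {k // G.Adj r k}, v ∈ branch G r k := by
  have h : (G.induce Set.univ).Reachable ⟨r, trivial⟩ ⟨v, trivial⟩ :=
    (hG.preconnected r v).map (SimpleGraph.induceUnivIso G).symm.toHom
  obtain ⟨k, hk, _, hv', _⟩ := exists_reachable_inter_branch _ _ hv h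
  exact ⟨⟨k, hk⟩, hv'.2⟩

theorem IsConnSubset.mem_of_mem_branch {V : Type*} {G : SimpleGraph V} (hG : G.IsAcyclic)
    {S : Set V} (hS : IsConnSubset G S) {r k v : V} (hr : r ∈ S) (hk : G.Adj r k)
    (hv : v ∈ S) (hvk : v ∈ branch G r k) : k ∈ S := by
  obtain ⟨l, hl, hlS, hvl, _⟩ := exists_reachable_inter_branch hr hv (ne_of_mem_branch hvk)
    (hS.preconnected _ _)
  rw [eq_of_mem_branch hG hk hl hvk hvl.2]
  exact hlS.1

theorem IsConnSubset.inter_branch {V : Type*} {G : SimpleGraph V} (hG : G.IsAcyclic)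
    {S : Set V} (hS : IsConnSubset G S) {r k : V} (hr : r ∈ S) (hk : G.Adj r k)
    (hkS : k ∈ S) : IsConnSubset G (S ∩ branch G r k) := by
  refine SimpleGraph.connected_iff_exists_forall_reachable _ |>.2
    ⟨⟨k, hkS, mem_branch_self hk⟩, ?_⟩
  rintro ⟨v, hv, hvk⟩
  obtain ⟨l, hl, hlS, hvl, h⟩ := exists_reachable_inter_branch hr hv (ne_of_mem_branch hvk)
    (hS.preconnected _ _)
  obtain rfl := eq_of_mem_branch hG hk hl hvk hvl.2
  exact h

/-- Gluing connected sets, each containing a neighbor of `r`, to `r` gives a connected set. -/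
theorem isConnSubset_insert_iUnion {V : Type*} {G : SimpleGraph V} {r : V}
    (C : {k // G.Adj r k} → Set V)
    (hC : ∀ k, (C k).Nonempty → k.1 ∈ C k ∧ IsConnSubset G (C k)) :
    IsConnSubset G (insert r (⋃ k, C k)) := by
  refine SimpleGraph.connected_iff_exists_forall_reachable _ |>.2
    ⟨⟨r, Set.mem_insert _ _⟩, ?_⟩
  rintro ⟨v, rfl | hv⟩
  · exact SimpleGraph.Reachable.refl _
  · obtain ⟨k, hvk⟩ := Set.mem_iUnion.1 hv
    obtain ⟨hk, hconn⟩ := hC k ⟨v, hvk⟩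
    have hsub : C k ⊆ insert r (⋃ k, C k) :=
      (Set.subset_iUnion C k).trans (Set.subset_insert _ _)
    have hadj : (G.induce (insert r (⋃ k, C k))).Adj ⟨r, Set.mem_insert _ _⟩ ⟨k.1, hsub hk⟩ :=
      k.2
    exact hadj.reachable.trans
      ((hconn.preconnected ⟨k.1, hk⟩ ⟨v, hvk⟩).map (SimpleGraph.induceHomOfLE G hsub).toHom)

theorem score_empty {V : Type*} (G : SimpleGraph V) (a : V → ℝ) (R : Sym2 V → ℝ)
    (D : V → V → ℝ) (W : Set V) : score G a R D W ∅ = 0 := by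
  have h₁ : {e : Sym2 V | e ∈ G.edgeSet ∧ ∀ v ∈ e, v ∈ (∅ : Set V)} = ∅ := by
    refine Set.eq_empty_of_forall_notMem ?_
    rintro ⟨x, y⟩ ⟨-, h⟩
    exact h x (Sym2.mem_mk_left x y)
  have h₂ : {p : V × V | G.Adj p.1 p.2 ∧ p.1 ∈ W ∧ p.2 ∈ W ∧ p.1 ∈ (∅ : Set V) ∧
      p.2 ∉ (∅ : Set V)} = ∅ :=
    Set.eq_empty_of_forall_notMem fun _ h => h.2.2.2.1
  unfold score
  rw [h₁, h₂, finsum_mem_empty, finsum_mem_empty, finsum_mem_empty, add_zero, add_zero]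

theorem finsum_mem_vertices {V : Type*} [Fintype V] {G : SimpleGraph V} (hG : G.IsTree)
    (a : V → ℝ) {r : V} {S : Set V} (hr : r ∈ S) :
    ∑ᶠ v ∈ S, a v = a r + ∑ k : {k // G.Adj r k}, ∑ᶠ v ∈ S ∩ branch G r k, a v := by
  have hS : S = insert r (⋃ k : {k // G.Adj r k}, S ∩ branch G r k) := by
    ext v
    by_cases hv : v = r
    · simp [hv, hr]
    · simp only [Set.mem_insert_iff, hv, false_or, Set.mem_iUnion, Set.mem_inter_iff]
      exact ⟨fun h => (exists_mem_branch hG.connected hv).imp fun _ hk => ⟨h, hk⟩,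
        fun ⟨_, h, _⟩ => h⟩
  conv_lhs => rw [hS]
  rw [finsum_mem_insert _ _ (Set.toFinite _), finsum_mem_iUnion _ fun _ => Set.toFinite _,
    finsum_eq_sum_of_fintype]
  · intro k l hkl
    refine Set.disjoint_left.2 fun v hk hl => hkl (Subtype.ext ?_)
    exact eq_of_mem_branch hG.isAcyclic k.2 l.2 hk.2 hl.2
  · intro h
    obtain ⟨k, -, hk⟩ := Set.mem_iUnion.1 h
    exact ne_of_mem_branch hk rfl

theorem finsum_mem_edges {V : Type*} [Fintype V] {G : SimpleGraph V} (hG : G.IsTree)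
    (R : Sym2 V → ℝ) {r : V} {S : Set V} (hr : r ∈ S) :
    ∑ᶠ e ∈ {e : Sym2 V | e ∈ G.edgeSet ∧ ∀ v ∈ e, v ∈ S}, R e =
      ∑ k : {k // G.Adj r k}, ((if k.1 ∈ S then R s(r, k.1) else 0) +
        ∑ᶠ e ∈ {e : Sym2 V | e ∈ G.edgeSet ∧ ∀ v ∈ e, v ∈ S ∩ branch G r k}, R e) := by
  have hS : {e : Sym2 V | e ∈ G.edgeSet ∧ ∀ v ∈ e, v ∈ S} =
      ⋃ k : {k // G.Adj r k}, ({e : Sym2 V | e = s(r, k.1) ∧ k.1 ∈ S} ∪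
        {e : Sym2 V | e ∈ G.edgeSet ∧ ∀ v ∈ e, v ∈ S ∩ branch G r k}) := by
    ext e
    simp only [Set.mem_iUnion, Set.mem_union, Set.mem_ofPred_eq]
    constructor
    · rintro ⟨he, heS⟩
      by_cases hre : r ∈ e
      · obtain ⟨k, rfl⟩ := hre
        exact ⟨⟨k, he⟩, Or.inl ⟨rfl, heS k (by simp)⟩⟩
      · induction e with | _ x y =>
        simp only [Sym2.mem_iff, not_or] at hre
        obtain ⟨k, hk⟩ := exists_mem_branch hG.connected (Ne.symm hre.1)
        refine ⟨k, Or.inr ⟨he, fun v hv => ⟨heS v hv, ?_⟩⟩⟩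
        obtain rfl | rfl := Sym2.mem_iff.1 hv
        · exact hk
        · exact mem_branch_of_adj hk he (Ne.symm hre.2)
    · rintro ⟨k, ⟨rfl, hk⟩ | ⟨he, h⟩⟩
      · refine ⟨k.2, fun v hv => ?_⟩
        obtain rfl | rfl := Sym2.mem_iff.1 hv
        · exact hr
        · exact hk
      · exact ⟨he, fun v hv => (h v hv).1⟩
  rw [hS, finsum_mem_iUnion _ fun _ => Set.toFinite _, finsum_eq_sum_of_fintype]
  · refine Finset.sum_congr rfl fun k _ => ?_
    rw [finsum_mem_union _ (Set.toFinite _) (Set.toFinite _)]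
    · congr 1
      by_cases hk : k.1 ∈ S
      · simp [hk]
      · simp [hk]
    · refine Set.disjoint_left.2 ?_
      rintro _ ⟨rfl, -⟩ ⟨-, h⟩
      exact ne_of_mem_branch (h r (by simp)).2 rfl
  · intro k l hkl
    refine Set.disjoint_left.2 ?_
    rintro e (⟨rfl, -⟩ | ⟨-, hk⟩) (⟨he, -⟩ | ⟨-, hl⟩)
    · exact hkl (Subtype.ext (Sym2.congr_right.1 he))
    · exact ne_of_mem_branch (hl r (by simp)).2 rfl
    · exact ne_of_mem_branch (hk r (by simp [he])).2 rfl
    · induction e with | _ x y =>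
      exact hkl (Subtype.ext (eq_of_mem_branch hG.isAcyclic k.2 l.2 (hk x (by simp)).2
        (hl x (by simp)).2))

theorem finsum_mem_boundary {V : Type*} [Fintype V] {G : SimpleGraph V} (hG : G.IsTree)
    (D : V → V → ℝ) {r : V} {S : Set V} (hr : r ∈ S) :
    ∑ᶠ p ∈ {p : V × V | G.Adj p.1 p.2 ∧ p.1 ∈ Set.univ ∧ p.2 ∈ Set.univ ∧ p.1 ∈ S ∧ p.2 ∉ S},
        D p.1 p.2 =
      ∑ k : {k // G.Adj r k}, ((if k.1 ∈ S then 0 else D r k) +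
        ∑ᶠ p ∈ {p : V × V | G.Adj p.1 p.2 ∧ p.1 ∈ branch G r k ∧ p.2 ∈ branch G r k ∧
          p.1 ∈ S ∩ branch G r k ∧ p.2 ∉ S ∩ branch G r k}, D p.1 p.2) := by
  have hS : {p : V × V | G.Adj p.1 p.2 ∧ p.1 ∈ Set.univ ∧ p.2 ∈ Set.univ ∧
        p.1 ∈ S ∧ p.2 ∉ S} =
      ⋃ k : {k // G.Adj r k}, ({p : V × V | p = (r, k.1) ∧ k.1 ∉ S} ∪
        {p : V × V | G.Adj p.1 p.2 ∧ p.1 ∈ branch G r k ∧ p.2 ∈ branch G r k ∧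
          p.1 ∈ S ∩ branch G r k ∧ p.2 ∉ S ∩ branch G r k}) := by
    ext ⟨x, y⟩
    simp only [Set.mem_iUnion, Set.mem_union, Set.mem_ofPred_eq, Set.mem_univ, true_and]
    constructor
    · rintro ⟨hxy, hx, hy⟩
      by_cases hxr : x = r
      · subst hxr
        exact ⟨⟨y, hxy⟩, Or.inl ⟨rfl, hy⟩⟩
      · obtain ⟨k, hk⟩ := exists_mem_branch hG.connected hxr
        refine ⟨k, Or.inr ⟨hxy, hk, mem_branch_of_adj hk hxy ?_, ⟨hx, hk⟩, fun h => hy h.1⟩⟩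
        rintro rfl
        exact hy hr
    · rintro ⟨k, ⟨h, hk⟩ | ⟨hxy, hx, hy, hxS, hyS⟩⟩
      · obtain ⟨rfl, rfl⟩ := Prod.mk.inj h
        exact ⟨k.2, hr, hk⟩
      · exact ⟨hxy, hxS.1, fun h => hyS ⟨h, hy⟩⟩
  rw [hS, finsum_mem_iUnion _ fun _ => Set.toFinite _, finsum_eq_sum_of_fintype]
  · refine Finset.sum_congr rfl fun k _ => ?_
    rw [finsum_mem_union _ (Set.toFinite _) (Set.toFinite _)]
    · congr 1
      by_cases hk : k.1 ∈ S
      · simp [hk]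
      · simp only [hk, not_false_eq_true, and_true, if_false]
        exact finsum_mem_singleton
    · refine Set.disjoint_left.2 ?_
      rintro _ ⟨rfl, -⟩ ⟨-, h, -⟩
      exact ne_of_mem_branch h rfl
  · intro k l hkl
    refine Set.disjoint_left.2 ?_
    rintro p (⟨rfl, -⟩ | ⟨-, hk, -⟩) (⟨he, -⟩ | ⟨-, hl, -⟩)
    · exact hkl (Subtype.ext (Prod.mk.inj he).2)
    · exact ne_of_mem_branch hl rfl
    · subst he
      exact ne_of_mem_branch hk rfl
    · exact hkl (Subtype.ext (eq_of_mem_branch hG.isAcyclic k.2 l.2 hk hl))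

/-- The score of a set containing `r` splits along the branches at `r`. -/
theorem score_eq_sum_branch {V : Type*} [Fintype V] {G : SimpleGraph V} (hG : G.IsTree)
    (a : V → ℝ) (R : Sym2 V → ℝ) (D : V → V → ℝ) {r : V} {S : Set V} (hr : r ∈ S) :
    score G a R D Set.univ S = a r + ∑ k : {k // G.Adj r k},
      ((if k.1 ∈ S then R s(r, k.1) else D r k) +
        score G a R D (branch G r k) (S ∩ branch G r k)) := by
  unfold score
  rw [finsum_mem_vertices hG a hr, finsum_mem_edges hG R hr, finsum_mem_boundary hG D hr,
    add_assoc, add_assoc, ← Finset.sum_add_distrib, ← Finset.sum_add_distrib]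
  congr 1
  refine Finset.sum_congr rfl fun k _ => ?_
  split_ifs <;> ring

/-- For a finite tree `G` and a vertex `r` with neighbor set `N(r)`, the
maximum of `F(S)` over all connected subsets `S` containing `r` equals
`a(r) + ∑_{k ∈ N(r)} max( D(r,k), R({r,k}) + M(k→r) )`, where `M(k→r)` is the maximum
of `F_{B(r,k)}(S')` over connected subsets `S'` of the branch `B(r,k)` containing `k`. -/
theorem stmt2 {V : Type*} [Fintype V] (G : SimpleGraph V) (hG : G.IsTree)
    (a : V → ℝ) (R : Sym2 V → ℝ) (D : V → V → ℝ) (r : V) :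
    IsGreatest
      {x : ℝ | ∃ S : Set V, r ∈ S ∧ IsConnSubset G S ∧ x = score G a R D Set.univ S}
      (a r + ∑ k : {k // G.Adj r k},
        max (D r (k : V))
          (R s(r, (k : V)) +
            sSup {x : ℝ | ∃ S' : Set V, S' ⊆ branch G r (k : V) ∧ (k : V) ∈ S' ∧
              IsConnSubset G S' ∧ x = score G a R D (branch G r (k : V)) S'})) := by
  let X : {k // G.Adj r k} → Set ℝ := fun k =>
    {x : ℝ | ∃ S' : Set V, S' ⊆ branch G r (k : V) ∧ (k : V) ∈ S' ∧
      IsConnSubset G S' ∧ x = score G a R D (branch G r (k : V)) S'}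
  have hfin : ∀ k, (X k).Finite := fun k =>
    (Set.finite_range (score G a R D (branch G r (k : V)))).subset
      (by rintro _ ⟨S', -, -, -, rfl⟩; exact ⟨S', rfl⟩)
  have hne : ∀ k, (X k).Nonempty := fun k => by
    refine ⟨_, {k.1}, Set.singleton_subset_iff.2 (mem_branch_self k.2), rfl, ?_, rfl⟩
    exact SimpleGraph.connected_iff_exists_forall_reachable _ |>.2
      ⟨⟨k.1, rfl⟩, fun ⟨v, hv⟩ => by obtain rfl := hv; exact SimpleGraph.Reachable.refl _⟩
  constructor
  · choose T hTsub hkT hT hTmax using fun k => (hne k).csSup_mem (hfin k)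
    let C : {k // G.Adj r k} → Set V := fun k =>
      if D r k < R s(r, k.1) + sSup (X k) then T k else ∅
    have hCsub : ∀ k, C k ⊆ branch G r k := fun k => by
      simp only [C]
      split_ifs
      · exact hTsub k
      · exact Set.empty_subset _
    have hC : ∀ k : {k // G.Adj r k}, insert r (⋃ l, C l) ∩ branch G r k = C k := fun k => by
      ext v
      constructor
      · rintro ⟨rfl | hv, hvk⟩
        · exact absurd rfl (ne_of_mem_branch hvk)
        · obtain ⟨l, hvl⟩ := Set.mem_iUnion.1 hv
          obtain rfl := Subtype.ext
            (eq_of_mem_branch hG.isAcyclic k.2 l.2 hvk (hCsub l hvl))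
          exact hvl
      · exact fun hv => ⟨Or.inr (Set.mem_iUnion.2 ⟨k, hv⟩), hCsub k hv⟩
    refine ⟨insert r (⋃ k, C k), Set.mem_insert _ _, isConnSubset_insert_iUnion C ?_, ?_⟩
    · intro k hk
      by_cases h : D r k < R s(r, k.1) + sSup (X k)
      · simp only [C, if_pos h]
        exact ⟨hkT k, hT k⟩
      · simp [C, if_neg h] at hk
    · rw [score_eq_sum_branch hG a R D (Set.mem_insert _ _)]
      congr 1
      refine Finset.sum_congr rfl fun k _ => ?_
      have hmem : k.1 ∈ insert r (⋃ l, C l) ↔ k.1 ∈ C k := by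
        rw [← hC k]
        exact ⟨fun h => ⟨h, mem_branch_self k.2⟩, fun h => h.1⟩
      rw [hC k]
      simp only [hmem]
      change max (D r k) (R s(r, k.1) + sSup (X k)) = _
      by_cases h : D r k < R s(r, k.1) + sSup (X k)
      · simp only [C, if_pos h, if_pos (hkT k)]
        rw [max_eq_right h.le, ← hTmax k]
      · simp only [C, if_neg h, Set.mem_empty_iff_false, if_false, score_empty, add_zero]
        exact max_eq_left (not_lt.1 h)
  · rintro _ ⟨S, hr, hS, rfl⟩
    rw [score_eq_sum_branch hG a R D hr]
    refine add_le_add_right (Finset.sum_le_sum fun k _ => ?_) _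
    by_cases hk : k.1 ∈ S
    · rw [if_pos hk]
      refine le_max_of_le_right (add_le_add_right (le_csSup (hfin k).bddAbove ?_) _)
      exact ⟨_, Set.inter_subset_right, ⟨hk, mem_branch_self k.2⟩,
        hS.inter_branch hG.isAcyclic hr k.2 hk, rfl⟩
    · have hempty : S ∩ branch G r k = ∅ := Set.eq_empty_of_forall_notMem fun v hv =>
        hk (hS.mem_of_mem_branch hG.isAcyclic hr k.2 hv.1 hv.2)
      rw [if_neg hk, hempty, score_empty, add_zero]
      exact le_max_left _ _
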